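/- arXiv:0811.3276 — 11 statements merged into one kernel-verified Lean document; each statement's English description precedes it below -/
import Mathlib

section
/- Let X be a topological space and let {A_ι} be a net in F(X) that is primitive with respect to the lower semifinite topology τ_w, i.e., the set of its τ_w-limits equals the set of its τ_w-cluster points. If there is a closed set A ⊆ X such that the set of all τ_w-limits of {A_ι} equals {B ∈ F(X) : B ⊆ A}, then {A_ι} converges to A in the Fell topology τ_s. -/
open Filter Set Topology TopologicalSpace

universe u v

/-- The lower semifinite topology `τ_w` on the hyperspace `F(X)` of closed subsets of `X`:
it is generated by the base of all sets `U(∅,Φ)` with `Φ` a finite family of open sets. -/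
def lowTop (X : Type u) [TopologicalSpace X] : TopologicalSpace (Closeds X) :=
  TopologicalSpace.generateFrom
    {U | ∃ Φ : Finset (Set X), (∀ O ∈ Φ, IsOpen O) ∧
      U = {A : Closeds X | ∀ O ∈ Φ, ((A : Set X) ∩ O).Nonempty}}

/-- The Fell topology `τ_s` on the hyperspace `F(X)` of closed subsets of `X`:
it is generated by the base of all sets `U(C,Φ)` with `C` compact and `Φ` a finite
family of open sets. -/
def fellTop (X : Type u) [TopologicalSpace X] : TopologicalSpace (Closeds X) :=
  TopologicalSpace.generateFrom
    {U | ∃ (C : Set X) (Φ : Finset (Set X)), IsCompact C ∧ (∀ O ∈ Φ, IsOpen O) ∧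
      U = {A : Closeds X | (A : Set X) ∩ C = ∅ ∧ ∀ O ∈ Φ, ((A : Set X) ∩ O).Nonempty}}

/-- `L ⊆ X` is a limit set if there is a net (equivalently, a `NeBot` filter)
converging to every point of `L`. -/
def IsLimitSet {X : Type u} [TopologicalSpace X] (L : Set X) : Prop :=
  ∃ F : Filter X, F.NeBot ∧ ∀ x ∈ L, F ≤ nhds x

/-- A maximal limit set: a limit set maximal with respect to inclusion among all limit sets. -/
def IsMaxLimitSet {X : Type u} [TopologicalSpace X] (L : Set X) : Prop :=
  IsLimitSet L ∧ ∀ M : Set X, IsLimitSet M → L ⊆ M → M = L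

/-- `L(X)`: the collection of all closed limit sets of `X`. -/
abbrev LX (X : Type u) [TopologicalSpace X] := {A : Closeds X // IsLimitSet (A : Set X)}

/-- `ML(X)`: the collection of all maximal limit sets of `X` (each of these is closed). -/
abbrev MLX (X : Type u) [TopologicalSpace X] := {A : Closeds X // IsMaxLimitSet (A : Set X)}

/-- The subspace topology induced by `τ_w` on `L(X)`. -/
def lowTopL (X : Type u) [TopologicalSpace X] : TopologicalSpace (LX X) :=
  (lowTop X).induced Subtype.val

/-- The subspace topology induced by `τ_s` on `L(X)`. -/
def fellTopL (X : Type u) [TopologicalSpace X] : TopologicalSpace (LX X) :=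
  (fellTop X).induced Subtype.val

/-- The subspace topology induced by `τ_w` on `ML(X)`. -/
def lowTopML (X : Type u) [TopologicalSpace X] : TopologicalSpace (MLX X) :=
  (lowTop X).induced Subtype.val

/-- The subspace topology induced by `τ_s` on `ML(X)`. -/
def fellTopML (X : Type u) [TopologicalSpace X] : TopologicalSpace (MLX X) :=
  (fellTop X).induced Subtype.val

/-- A point `y` is separated in `Y` if every `z ∉ closure {y}` admits a neighbourhood
disjoint from some neighbourhood of `y`. -/
def IsSeparatedPt {Y : Type v} [TopologicalSpace Y] (y : Y) : Prop :=
  ∀ z : Y, z ∉ closure {y} → ∃ U ∈ nhds y, ∃ V ∈ nhds z, Disjoint U V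
/-- If a family of closed sets eventually meets the compact set `C` along an ultrafilter, then it
`τ_w`-converges along that ultrafilter to the closure of some point of `C`. -/
theorem exists_tendsto_lowTop_closure_singleton {X : Type u} [TopologicalSpace X] {ι : Type v}
    {A : ι → Closeds X} {C : Set X} (hC : IsCompact C) (G : Ultrafilter ι)
    (hG : ∀ᶠ i in (G : Filter ι), ((A i : Set X) ∩ C).Nonempty) :
    ∃ x ∈ C, Tendsto A G (@nhds _ (lowTop X) (Closeds.closure {x})) := by
  obtain ⟨i₀, x₀, -⟩ := hG.exists
  have hchoice : ∀ i, ∃ y, ((A i : Set X) ∩ C).Nonempty → y ∈ (A i : Set X) ∩ C := fun i => by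
    by_cases h : ((A i : Set X) ∩ C).Nonempty
    · exact h.imp fun y hy _ => hy
    · exact ⟨x₀, fun h' => absurd h' h⟩
  choose y hy using hchoice
  obtain ⟨x, hxC, hx⟩ := hC.ultrafilter_le_nhds (G.map y)
    (le_principal_iff.2 <| hG.mono fun i hi => (hy i hi).2)
  have hx' : Tendsto y G (nhds x) := hx
  refine ⟨x, hxC, tendsto_nhds_generateFrom_iff.2 ?_⟩
  rintro U ⟨Φ, hΦ, rfl⟩ hU
  have hmem : ∀ᶠ i in (G : Filter ι), ∀ O ∈ Φ, y i ∈ O := by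
    rw [Filter.eventually_all_finset]
    intro O hO
    have hxO : x ∈ O := by
      have h : (closure {x} ∩ O).Nonempty := hU O hO
      simpa using (closure_inter_open_nonempty_iff (hΦ O hO)).1 h
    exact hx'.eventually ((hΦ O hO).mem_nhds hxO)
  filter_upwards [hG, hmem] with i hi hi' O hO
  exact ⟨y i, (hy i hi).1, hi' O hO⟩

/-- a `τ_w`-primitive net of closed sets whose set of `τ_w`-limits is
`{B ∈ F(X) : B ⊆ A₀}` is `τ_s`-convergent to `A₀`. -/
theorem fell_tendsto_of_primitive {X : Type u} [TopologicalSpace X]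
    {ι : Type v} [Preorder ι] [IsDirected ι (· ≤ ·)] [Nonempty ι]
    (A : ι → Closeds X) (A₀ : Closeds X)
    (hprim : {B : Closeds X | Tendsto A atTop (@nhds _ (lowTop X) B)} =
      {B : Closeds X | @ClusterPt _ (lowTop X) B (Filter.map A Filter.atTop)})
    (hlim : {B : Closeds X | Tendsto A atTop (@nhds _ (lowTop X) B)} =
      {B : Closeds X | (B : Set X) ⊆ (A₀ : Set X)}) :
    Tendsto A atTop (@nhds _ (fellTop X) A₀) := by
  have hA₀ : Tendsto A atTop (@nhds _ (lowTop X) A₀) :=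
    (Set.ext_iff.1 hlim A₀).2 (Subset.refl (A₀ : Set X))
  refine tendsto_nhds_generateFrom_iff.2 ?_
  rintro U ⟨C, Φ, hC, hΦ, rfl⟩ ⟨hAC, hAΦ⟩
  have hmeet : ∀ᶠ i in atTop, ∀ O ∈ Φ, ((A i : Set X) ∩ O).Nonempty :=
    tendsto_nhds_generateFrom_iff.1 hA₀ _ ⟨Φ, hΦ, rfl⟩ hAΦ
  have hmiss : ∀ᶠ i in atTop, (A i : Set X) ∩ C = ∅ := by
    by_contra hfreq
    have hne : (atTop ⊓ 𝓟 {i | ((A i : Set X) ∩ C).Nonempty}).NeBot := by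
      rw [← Filter.frequently_mem_iff_neBot]
      simpa [Filter.Frequently, Set.not_nonempty_iff_eq_empty] using hfreq
    let G := Ultrafilter.of (atTop ⊓ 𝓟 {i | ((A i : Set X) ∩ C).Nonempty})
    have hG := Ultrafilter.of_le (atTop ⊓ 𝓟 {i | ((A i : Set X) ∩ C).Nonempty})
    obtain ⟨x, hxC, hx⟩ := exists_tendsto_lowTop_closure_singleton hC G
      (le_principal_iff.1 (hG.trans inf_le_right))
    have hcluster : @ClusterPt _ (lowTop X) (Closeds.closure {x}) (map A atTop) :=
      NeBot.mono (inferInstance : (map A (G : Filter ι)).NeBot)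
        (le_inf hx (map_mono (hG.trans inf_le_left)))
    have hsub : closure {x} ⊆ (A₀ : Set X) :=
      (Set.ext_iff.1 (hlim.symm.trans hprim) (Closeds.closure {x})).2 hcluster
    exact (Set.eq_empty_iff_forall_notMem.1 hAC x) ⟨hsub (subset_closure rfl), hxC⟩
  exact hmiss.and hmeet
end

section
/- Let X be a locally compact topological space, let {A_ι} be a net in F(X), and let A ∈ F(X). If {A_ι} converges to A in the Fell topology τ_s, then {A_ι} is a primitive net in (F(X), τ_w) (the set of its τ_w-limits equals the set of its τ_w-cluster points) and the set of all its τ_w-limits is exactly {B ∈ F(X) : B ⊆ A}. -/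
open Filter Set Topology TopologicalSpace

universe u v

theorem isOpen_lowTop_hit {X : Type u} [TopologicalSpace X] {O : Set X} (hO : IsOpen O) :
    IsOpen[lowTop X] {B : Closeds X | ((B : Set X) ∩ O).Nonempty} :=
  TopologicalSpace.isOpen_generateFrom_of_mem ⟨{O}, by simpa using hO, by simp⟩

theorem isOpen_fellTop_hit {X : Type u} [TopologicalSpace X] {Φ : Finset (Set X)}
    (hΦ : ∀ O ∈ Φ, IsOpen O) :
    IsOpen[fellTop X] {B : Closeds X | ∀ O ∈ Φ, ((B : Set X) ∩ O).Nonempty} :=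
  TopologicalSpace.isOpen_generateFrom_of_mem ⟨∅, Φ, isCompact_empty, hΦ, by simp⟩

theorem isOpen_fellTop_miss {X : Type u} [TopologicalSpace X] {C : Set X} (hC : IsCompact C) :
    IsOpen[fellTop X] {B : Closeds X | (B : Set X) ∩ C = ∅} :=
  TopologicalSpace.isOpen_generateFrom_of_mem ⟨C, ∅, hC, by simp, by simp⟩

/-- A Fell limit of a filter is a limit in the lower semifinite topology,
and so is every closed subset of it. -/
theorem le_nhds_lowTop_of_subset {X : Type u} [TopologicalSpace X] {F : Filter (Closeds X)}
    {A B : Closeds X} (h : F ≤ @nhds _ (fellTop X) A) (hBA : (B : Set X) ⊆ A) :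
    F ≤ @nhds _ (lowTop X) B := by
  rw [lowTop, nhds_generateFrom]
  simp only [le_iInf_iff, le_principal_iff]
  rintro _ ⟨hB, Φ, hΦ, rfl⟩
  exact h ((@IsOpen.mem_nhds_iff _ (fellTop X) A _ (isOpen_fellTop_hit hΦ)).2
    fun O hO ↦ (hB O hO).mono (inter_subset_inter_left _ hBA))

/-- Over a locally compact space, a cluster point in the lower semifinite topology of a
Fell-convergent filter is contained in the Fell limit. -/
theorem subset_of_clusterPt_lowTop {X : Type u} [TopologicalSpace X] [LocallyCompactSpace X]
    {F : Filter (Closeds X)} {A B : Closeds X} (h : F ≤ @nhds _ (fellTop X) A)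
    (hB : @ClusterPt _ (lowTop X) B F) : (B : Set X) ⊆ A := by
  intro x hxB
  by_contra hxA
  obtain ⟨K, hKx, hKA, hK⟩ := local_compact_nhds (A.isClosed.isOpen_compl.mem_nhds hxA)
  have hmiss : {D : Closeds X | (D : Set X) ∩ K = ∅} ∈ F :=
    h ((@IsOpen.mem_nhds_iff _ (fellTop X) A _ (isOpen_fellTop_miss hK)).2
      (disjoint_iff_inter_eq_empty.1 (subset_compl_iff_disjoint_left.1 hKA)))
  have hhit : {D : Closeds X | ((D : Set X) ∩ interior K).Nonempty} ∈ @nhds _ (lowTop X) B :=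
    (@IsOpen.mem_nhds_iff _ (lowTop X) B _ (isOpen_lowTop_hit isOpen_interior)).2
      ⟨x, hxB, mem_interior_iff_mem_nhds.2 hKx⟩
  obtain ⟨D, hD, hDK⟩ := (@clusterPt_iff_nonempty _ (lowTop X) _ _).1 hB hhit hmiss
  exact (hD.mono (inter_subset_inter_right _ interior_subset)).ne_empty hDK

/-- over a locally compact space, a net of closed sets that is
`τ_s`-convergent to `A₀` is `τ_w`-primitive and its set of `τ_w`-limits is
`{B ∈ F(X) : B ⊆ A₀}`. -/
theorem primitive_of_fell_tendsto {X : Type u} [TopologicalSpace X] [LocallyCompactSpace X]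
    {ι : Type v} [Preorder ι] [IsDirected ι (· ≤ ·)] [Nonempty ι]
    (A : ι → Closeds X) (A₀ : Closeds X)
    (h : Tendsto A atTop (@nhds _ (fellTop X) A₀)) :
    {B : Closeds X | Tendsto A atTop (@nhds _ (lowTop X) B)} =
      {B : Closeds X | @ClusterPt _ (lowTop X) B (Filter.map A Filter.atTop)} ∧
    {B : Closeds X | Tendsto A atTop (@nhds _ (lowTop X) B)} =
      {B : Closeds X | (B : Set X) ⊆ (A₀ : Set X)} := by
  have hcluster (B : Closeds X) (hB : Tendsto A atTop (@nhds _ (lowTop X) B)) :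
      @ClusterPt _ (lowTop X) B (map A atTop) :=
    @ClusterPt.of_le_nhds _ (lowTop X) _ _ hB _
  refine ⟨Subset.antisymm hcluster fun B hB ↦ ?_, Subset.antisymm (fun B hB ↦ ?_) fun B hB ↦ ?_⟩
  · exact le_nhds_lowTop_of_subset h (subset_of_clusterPt_lowTop h hB)
  · exact subset_of_clusterPt_lowTop h (hcluster B hB)
  · exact le_nhds_lowTop_of_subset h hB
end

section
/- Let C_1, …, C_n be compact subsets of a topological space X. Then the set S := {A ∈ F(X) : A ∩ C_i ≠ ∅ for all i = 1, …, n} is compact in the lower semifinite topology τ_w on F(X). -/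
open Filter Set Topology TopologicalSpace

universe u v

/-- The lower limit of an ultrafilter of closed sets: the points all of whose neighbourhoods
are eventually met. -/
def Ultrafilter.lowerLimit {X : Type u} [TopologicalSpace X] (F : Ultrafilter (Closeds X)) :
    Closeds X where
  carrier := {x | ∀ O, IsOpen O → x ∈ O → ∀ᶠ B : Closeds X in F, ((B : Set X) ∩ O).Nonempty}
  isClosed' := by
    rw [← isOpen_compl_iff, isOpen_iff_forall_mem_open]
    intro x hx
    simp only [mem_compl_iff, mem_ofPred_eq, not_forall] at hx
    obtain ⟨O, hO, hxO, hF⟩ := hx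
    exact ⟨O, fun y hy hy' => hF (hy' O hO hy), hO, hxO⟩

theorem Ultrafilter.le_nhds_lowerLimit {X : Type u} [TopologicalSpace X]
    (F : Ultrafilter (Closeds X)) : (F : Filter (Closeds X)) ≤ @nhds _ (lowTop X) F.lowerLimit := by
  rw [lowTop, nhds_generateFrom]
  simp only [le_iInf_iff, le_principal_iff]
  rintro _ ⟨hA, Φ, hΦ, rfl⟩
  have h : ∀ᶠ B : Closeds X in F, ∀ O ∈ Φ, ((B : Set X) ∩ O).Nonempty := by
    rw [Filter.eventually_all_finset]
    intro O hO
    obtain ⟨x, hx, hxO⟩ := hA O hO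
    exact hx O (hΦ O hO) hxO
  exact h

theorem Ultrafilter.lowerLimit_inter_nonempty {X : Type u} [TopologicalSpace X]
    (F : Ultrafilter (Closeds X)) {K : Set X} (hK : IsCompact K)
    (hF : ∀ᶠ B : Closeds X in F, ((B : Set X) ∩ K).Nonempty) :
    ((F.lowerLimit : Set X) ∩ K).Nonempty := by
  by_contra hne
  have h : ∀ᶠ B : Closeds X in F, ¬ ((B : Set X) ∩ K).Nonempty := by
    refine hK.induction_on (p := fun s => ∀ᶠ B : Closeds X in F, ¬ ((B : Set X) ∩ s).Nonempty)
      (by simp) (fun s t hst ht => ?_) (fun s t hs ht => ?_) (fun x hx => ?_)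
    · exact ht.mono fun B hB hs => hB (hs.mono (inter_subset_inter_right _ hst))
    · filter_upwards [hs, ht] with B hBs hBt
      rw [inter_union_distrib_left, union_nonempty]
      exact not_or.mpr ⟨hBs, hBt⟩
    · have hx' : ¬ ∀ O, IsOpen O → x ∈ O → ∀ᶠ B : Closeds X in F, ((B : Set X) ∩ O).Nonempty :=
        fun hx' => hne ⟨x, hx', hx⟩
      simp only [not_forall] at hx'
      obtain ⟨O, hO, hxO, hFO⟩ := hx'
      exact ⟨O, mem_nhdsWithin_of_mem_nhds (hO.mem_nhds hxO), Ultrafilter.eventually_not.mpr hFO⟩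
  obtain ⟨B, hB, hB'⟩ := (hF.and h).exists
  exact hB' hB

/-- for compact sets `C 1, …, C n`, the set of closed sets meeting
every `C i` is `τ_w`-compact. -/
theorem tauW_isCompact_sets_meeting_compacts {X : Type u} [TopologicalSpace X]
    {n : ℕ} (C : Fin n → Set X) (hC : ∀ i, IsCompact (C i)) :
    @IsCompact (Closeds X) (lowTop X)
      {A : Closeds X | ∀ i, ((A : Set X) ∩ C i).Nonempty} := by
  let := lowTop X
  rw [isCompact_iff_ultrafilter_le_nhds]
  intro F hF
  refine ⟨F.lowerLimit, fun i => F.lowerLimit_inter_nonempty (hC i) ?_, F.le_nhds_lowerLimit⟩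
  exact mem_of_superset (le_principal_iff.mp hF) fun B hB => hB i
end

section
/- If X is a Baire topological space, then (L(X), τ_w) and (L'(X), τ_w) are Baire spaces. -/
open Filter Set Topology TopologicalSpace

universe u v

/-- A space admitting a dense inducing map from a Baire space is a Baire space. -/
theorem IsDenseInducing.baireSpace {X : Type u} {Y : Type v} [TopologicalSpace X]
    [TopologicalSpace Y] [BaireSpace X] {f : X → Y} (hf : IsDenseInducing f) : BaireSpace Y where
  baire_property D hDo hDd := by
    have hdense : Dense (⋂ n, f ⁻¹' D n) := by
      refine dense_iInter_of_isOpen_nat (fun n => (hDo n).preimage hf.continuous) fun n => ?_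
      refine dense_iff_inter_open.2 fun V hV ⟨x, hx⟩ => ?_
      obtain ⟨W, hW, rfl⟩ := hf.isInducing.isOpen_iff.1 hV
      obtain ⟨x', hx'⟩ := hf.dense.exists_mem_open (hW.inter (hDo n))
        ((hDd n).inter_open_nonempty W hW ⟨f x, hx⟩)
      exact ⟨x', hx'⟩
    refine dense_iff_inter_open.2 fun W hW hne => ?_
    obtain ⟨x, hx⟩ := hf.dense.exists_mem_open hW hne
    obtain ⟨y, hyW, hyD⟩ := hdense.inter_open_nonempty _ (hW.preimage hf.continuous) ⟨x, hx⟩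
    exact ⟨f y, hyW, mem_iInter.2 fun n => mem_iInter.1 hyD n⟩

theorem closure_singleton_inter_nonempty_iff {X : Type u} [TopologicalSpace X] {x : X} {O : Set X}
    (hO : IsOpen O) : (closure {x} ∩ O).Nonempty ↔ x ∈ O := by
  rw [closure_inter_open_nonempty_iff hO, singleton_inter_nonempty]

theorem isLimitSet_closure_singleton {X : Type u} [TopologicalSpace X] (x : X) :
    IsLimitSet (closure {x}) :=
  ⟨pure x, pure_neBot, fun _ hy => (specializes_iff_mem_closure.2 hy).pure_le_nhds⟩

theorem isInducing_closure_singleton (X : Type u) [TopologicalSpace X] :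
    @IsInducing X (Closeds X) _ (lowTop X) fun x => Closeds.closure {x} := by
  let := lowTop X
  refine ⟨le_antisymm (continuous_iff_le_induced.1 (continuous_generateFrom_iff.2 ?_)) ?_⟩
  · rintro _ ⟨Φ, hΦ, rfl⟩
    have h : (fun x : X => Closeds.closure {x}) ⁻¹'
        {A : Closeds X | ∀ O ∈ Φ, ((A : Set X) ∩ O).Nonempty} = ⋂ O ∈ Φ, O := by
      ext x
      simp only [mem_preimage, mem_ofPred_eq, mem_iInter, Closeds.coe_closure]
      exact forall₂_congr fun O hO => closure_singleton_inter_nonempty_iff (hΦ O hO)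
    rw [h]
    exact isOpen_biInter_finset hΦ
  · intro O hO
    refine isOpen_induced_iff.2 ⟨{A : Closeds X | ∀ O' ∈ ({O} : Finset (Set X)),
      ((A : Set X) ∩ O').Nonempty}, .basic _ ⟨{O}, by simpa using hO, rfl⟩, ?_⟩
    ext x
    simp [closure_singleton_inter_nonempty_iff hO]

/-- If a filter converges to every point of `A`, then the closures of points converge to `A`
along it. -/
theorem tendsto_closure_singleton {X : Type u} [TopologicalSpace X] {A : Closeds X} {F : Filter X}
    (hF : ∀ x ∈ (A : Set X), F ≤ 𝓝 x) :
    Tendsto (fun x => Closeds.closure {x}) F (@nhds _ (lowTop X) A) := by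
  refine tendsto_nhds_generateFrom_iff.2 ?_
  rintro _ ⟨Φ, hΦ, rfl⟩ hA
  have h : ∀ᶠ x in F, ∀ O ∈ Φ, x ∈ O := (eventually_all_finset Φ).2 fun O hO =>
    let ⟨a, ha, haO⟩ := hA O hO
    hF a ha ((hΦ O hO).mem_nhds haO)
  filter_upwards [h] with x hx O hO
  exact (closure_singleton_inter_nonempty_iff (hΦ O hO)).2 (hx O hO)

/-- Every family of closed limit sets containing the closures of points is a Baire space
in the lower semifinite topology as soon as `X` is. -/
theorem baireSpace_lowTop_subtype {X : Type u} [TopologicalSpace X] [BaireSpace X]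
    {P : Closeds X → Prop} (hP : ∀ A, P A → IsLimitSet (A : Set X))
    (hcl : ∀ x : X, P (Closeds.closure {x})) :
    @BaireSpace {A : Closeds X // P A} ((lowTop X).induced Subtype.val) := by
  let := lowTop X
  let f : X → {A : Closeds X // P A} := fun x => ⟨Closeds.closure {x}, hcl x⟩
  have hf : IsInducing f := (IsInducing.of_comp_iff IsInducing.subtypeVal).1
    (isInducing_closure_singleton X)
  refine IsDenseInducing.baireSpace (f := f) ⟨hf, fun A => ?_⟩
  obtain ⟨F, hne, hF⟩ := hP A.1 A.2
  have hlim : Tendsto f F (𝓝 A) := tendsto_subtype_rng.2 (tendsto_closure_singleton hF)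
  exact mem_closure_of_tendsto hlim (Eventually.of_forall mem_range_self)

/-- if `X` is a Baire space then `(L(X), τ_w)` and `(L'(X), τ_w)`
are Baire spaces. -/
theorem tauW_baire {X : Type u} [TopologicalSpace X] [BaireSpace X] :
    @BaireSpace (LX X) (lowTopL X) ∧
    @BaireSpace {A : Closeds X // IsLimitSet (A : Set X) ∧ (A : Set X).Nonempty}
      ((lowTop X).induced Subtype.val) := by
  exact ⟨baireSpace_lowTop_subtype (fun _ h => h) isLimitSet_closure_singleton,
    baireSpace_lowTop_subtype (fun _ h => h.1) fun x =>
      ⟨isLimitSet_closure_singleton x, x, subset_closure rfl⟩⟩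
end

section
/- If a topological space X has a base for its topology consisting of sets that are both open and compact, then each of the spaces (F(X), τ_w), (F'(X), τ_w), (L(X), τ_w), and (L'(X), τ_w) has a base for its topology consisting of sets that are both open and compact. -/
open Filter Set Topology TopologicalSpace

universe u v

/-- The closed sets meeting every member of `Φ`, i.e. the set `U(∅, Φ)`. -/
def hitSet {X : Type u} [TopologicalSpace X] (Φ : Finset (Set X)) : Set (Closeds X) :=
  {A | ∀ O ∈ Φ, ((A : Set X) ∩ O).Nonempty}

section

variable {X : Type u} [TopologicalSpace X]

attribute [local instance] lowTop

theorem isTopologicalBasis_hitSet :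
    IsTopologicalBasis {U : Set (Closeds X) | ∃ Φ : Finset (Set X), (∀ O ∈ Φ, IsOpen O) ∧
      U = hitSet Φ} where
  exists_subset_inter := by
    classical
    rintro _ ⟨Φ, hΦ, rfl⟩ _ ⟨Ψ, hΨ, rfl⟩ A ⟨hA, hA'⟩
    refine ⟨_, ⟨Φ ∪ Ψ, ?_, rfl⟩, ?_, fun B hB => ⟨fun O hO => ?_, fun O hO => ?_⟩⟩
    · intro O hO
      exact (Finset.mem_union.1 hO).elim (hΦ O) (hΨ O)
    · intro O hO
      exact (Finset.mem_union.1 hO).elim (hA O) (hA' O)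
    · exact hB O (Finset.mem_union_left _ hO)
    · exact hB O (Finset.mem_union_right _ hO)
  sUnion_eq := eq_univ_of_forall fun A =>
    mem_sUnion.2 ⟨hitSet ∅, ⟨∅, by simp, rfl⟩, fun O hO => by simp at hO⟩
  eq_generateFrom := rfl

theorem isOpen_hitSet {Φ : Finset (Set X)} (hΦ : ∀ O ∈ Φ, IsOpen O) : IsOpen (hitSet Φ) :=
  isTopologicalBasis_hitSet.isOpen ⟨Φ, hΦ, rfl⟩

/-- Every ultrafilter of closed sets converges to the set of points all of whose
neighbourhoods are met eventually. -/
theorem isCompact_hitSet {Φ : Finset (Set X)} (hΦ : ∀ K ∈ Φ, IsCompact K) :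
    IsCompact (hitSet Φ) := by
  refine isCompact_iff_ultrafilter_le_nhds'.2 fun 𝒰 h𝒰 => ?_
  let S : Set X := {x | ∀ O, IsOpen O → x ∈ O → ∀ᶠ B : Closeds X in 𝒰, ((B : Set X) ∩ O).Nonempty}
  have hS : IsClosed S := by
    refine isClosed_of_closure_subset fun x hx O hO hxO => ?_
    obtain ⟨y, hyO, hy⟩ := mem_closure_iff.1 hx O hO hxO
    exact hy O hO hyO
  refine ⟨⟨S, hS⟩, fun K hK => ?_, ?_⟩
  · by_contra hne
    have hmiss : ∀ x ∈ K, ∃ O, IsOpen O ∧ x ∈ O ∧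
        ∀ᶠ B : Closeds X in 𝒰, ¬((B : Set X) ∩ O).Nonempty := by
      intro x hx
      by_contra hcon
      refine hne ⟨x, fun O hO hxO => ?_, hx⟩
      by_contra hmet
      exact hcon ⟨O, hO, hxO, Ultrafilter.eventually_not.2 hmet⟩
    have hK' : ∀ᶠ B : Closeds X in 𝒰, ¬((B : Set X) ∩ K).Nonempty := by
      refine (hΦ K hK).induction_on
        (p := fun s => ∀ᶠ B : Closeds X in 𝒰, ¬((B : Set X) ∩ s).Nonempty) (by simp) ?_ ?_ ?_
      · exact fun s t hst ht => ht.mono fun B hB h => hB (h.mono (inter_subset_inter_right _ hst))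
      · intro s t hs ht
        filter_upwards [hs, ht] with B h₁ h₂
        rw [inter_union_distrib_left, union_nonempty]
        exact not_or.2 ⟨h₁, h₂⟩
      · intro x hx
        obtain ⟨O, hO, hxO, h⟩ := hmiss x hx
        exact ⟨O, mem_nhdsWithin_of_mem_nhds (hO.mem_nhds hxO), h⟩
    obtain ⟨B, hB, hB'⟩ := (hK'.and h𝒰).exists
    exact hB (hB' K hK)
  · refine (isTopologicalBasis_hitSet.nhds_hasBasis.ge_iff).2 ?_
    rintro _ ⟨⟨Ψ, hΨ, rfl⟩, hA⟩
    refine (Filter.eventually_all_finset Ψ).2 fun O hO => ?_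
    obtain ⟨x, hx, hxO⟩ := hA O hO
    exact hx O (hΨ O hO) hxO

theorem isLimitSet_iff {L : Set X} :
    IsLimitSet L ↔ ∀ Φ : Finset (Set X), (∀ O ∈ Φ, IsOpen O) → (∀ O ∈ Φ, (L ∩ O).Nonempty) →
      (⋂₀ (Φ : Set (Set X))).Nonempty := by
  constructor
  · rintro ⟨F, hF, hL⟩ Φ hΦ hLΦ
    refine hF.nonempty_of_mem ((sInter_mem Φ.finite_toSet).2 fun O hO => ?_)
    obtain ⟨x, hx, hxO⟩ := hLΦ O hO
    exact hL x hx ((hΦ O hO).mem_nhds hxO)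
  · intro h
    refine ⟨generate {O | IsOpen O ∧ (L ∩ O).Nonempty}, generate_neBot_iff.2 fun t ht hfin => ?_,
      fun x hx => ?_⟩
    · have := h hfin.toFinset (fun O hO => (ht (hfin.mem_toFinset.1 hO)).1)
        (fun O hO => (ht (hfin.mem_toFinset.1 hO)).2)
      rwa [hfin.coe_toFinset] at this
    · refine (nhds_basis_opens x).ge_iff.2 fun O hO => ?_
      exact mem_generate_of_mem ⟨hO.2, x, hx, hO.1⟩

theorem isClosed_setOf_isLimitSet : IsClosed {A : Closeds X | IsLimitSet (A : Set X)} := by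
  refine isClosed_of_closure_subset fun A hA => isLimitSet_iff.2 fun Φ hΦ hAΦ => ?_
  obtain ⟨B, hBΦ, hB⟩ := mem_closure_iff.1 hA _ (isOpen_hitSet hΦ) hAΦ
  exact isLimitSet_iff.1 hB Φ hΦ hBΦ

theorem isOpen_setOf_nonempty : IsOpen {A : Closeds X | (A : Set X).Nonempty} := by
  have := isOpen_hitSet (X := X) (Φ := {univ}) (by simp)
  simpa [hitSet] using this

theorem prespectralSpace_closeds [PrespectralSpace X] : PrespectralSpace (Closeds X) where
  isTopologicalBasis := by
    classical
    refine isTopologicalBasis_of_isOpen_of_nhds (fun U hU => hU.1) fun A U hAU hU => ?_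
    obtain ⟨_, ⟨Φ, hΦ, rfl⟩, hA, hΦU⟩ := isTopologicalBasis_hitSet.exists_subset_of_mem_open hAU hU
    have hK : ∀ O : Φ, ∃ K, (IsOpen K ∧ IsCompact K) ∧ ((A : Set X) ∩ K).Nonempty ∧ K ⊆ O := by
      rintro ⟨O, hO⟩
      obtain ⟨x, hx, hxO⟩ := hA O hO
      obtain ⟨K, hK, hxK, hKO⟩ :=
        PrespectralSpace.isTopologicalBasis.exists_subset_of_mem_open hxO (hΦ O hO)
      exact ⟨K, hK, ⟨x, hx, hxK⟩, hKO⟩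
    choose K hK hAK hKO using hK
    refine ⟨hitSet (Finset.univ.image K), ⟨isOpen_hitSet ?_, isCompact_hitSet ?_⟩, ?_,
      fun B hB => hΦU fun O hO => ?_⟩
    · exact Finset.forall_mem_image.2 fun O _ => (hK O).1
    · exact Finset.forall_mem_image.2 fun O _ => (hK O).2
    · exact Finset.forall_mem_image.2 fun O _ => hAK O
    · exact (hB (K ⟨O, hO⟩) (Finset.mem_image_of_mem K (Finset.mem_univ _))).mono
        (inter_subset_inter_right _ (hKO ⟨O, hO⟩))

end

theorem IsLocallyClosed.prespectralSpace {Y : Type v} [TopologicalSpace Y] [PrespectralSpace Y]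
    {s : Set Y} (hs : IsLocallyClosed s) : PrespectralSpace s where
  isTopologicalBasis := by
    obtain ⟨U, Z, hU, hZ, rfl⟩ := hs
    refine isTopologicalBasis_of_isOpen_of_nhds (fun V hV => hV.1) ?_
    rintro ⟨y, hyU, hyZ⟩ _ hyW ⟨W, hW, rfl⟩
    obtain ⟨K, ⟨hKo, hKc⟩, hyK, hKWU⟩ := PrespectralSpace.isTopologicalBasis.exists_subset_of_mem_open
      (show y ∈ W ∩ U from ⟨hyW, hyU⟩) (hW.inter hU)
    refine ⟨Subtype.val ⁻¹' K, ⟨hKo.preimage continuous_subtype_val, ?_⟩, hyK,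
      preimage_mono fun z hz => (hKWU hz).1⟩
    rw [Subtype.isCompact_iff, Subtype.image_preimage_coe]
    have : U ∩ Z ∩ K = K ∩ Z := by
      ext z
      exact ⟨fun h => ⟨h.2, h.1.2⟩, fun h => ⟨⟨(hKWU h.1).2, h.2⟩, h.1⟩⟩
    rw [this]
    exact hKc.inter_right hZ

theorem PrespectralSpace.exists_isTopologicalBasis {Y : Type v} [TopologicalSpace Y]
    [PrespectralSpace Y] : ∃ B : Set (Set Y), IsTopologicalBasis B ∧ ∀ s ∈ B, IsCompact s :=
  ⟨_, PrespectralSpace.isTopologicalBasis, fun _ hs => hs.2⟩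


/-- if `X` has a base of open compact sets then so do `(F(X), τ_w)`,
`(F'(X), τ_w)`, `(L(X), τ_w)` and `(L'(X), τ_w)`. -/
theorem tauW_basis_of_compact_opens {X : Type u} [TopologicalSpace X]
    (hX : ∃ B : Set (Set X), IsTopologicalBasis B ∧ ∀ s ∈ B, IsCompact s) :
    (∃ B : Set (Set (Closeds X)), @IsTopologicalBasis _ (lowTop X) B ∧
      ∀ s ∈ B, @IsCompact _ (lowTop X) s) ∧
    (∃ B : Set (Set {A : Closeds X // (A : Set X).Nonempty}),
      @IsTopologicalBasis _ ((lowTop X).induced Subtype.val) B ∧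
      ∀ s ∈ B, @IsCompact _ ((lowTop X).induced Subtype.val) s) ∧
    (∃ B : Set (Set (LX X)), @IsTopologicalBasis _ (lowTopL X) B ∧
      ∀ s ∈ B, @IsCompact _ (lowTopL X) s) ∧
    (∃ B : Set (Set {A : Closeds X // IsLimitSet (A : Set X) ∧ (A : Set X).Nonempty}),
      @IsTopologicalBasis _ ((lowTop X).induced Subtype.val) B ∧
      ∀ s ∈ B, @IsCompact _ ((lowTop X).induced Subtype.val) s) := by
  obtain ⟨B, hB, hBc⟩ := hX
  have : PrespectralSpace X := .of_isTopologicalBasis hB hBc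
  let : TopologicalSpace (Closeds X) := lowTop X
  have : PrespectralSpace (Closeds X) := prespectralSpace_closeds
  have hN := isOpen_setOf_nonempty (X := X)
  have hL := isClosed_setOf_isLimitSet (X := X)
  have hF' := hN.isLocallyClosed.prespectralSpace
  have hLX := hL.isLocallyClosed.prespectralSpace
  have hL' := (hL.isLocallyClosed.inter hN.isLocallyClosed).prespectralSpace
  exact ⟨PrespectralSpace.exists_isTopologicalBasis, hF'.exists_isTopologicalBasis,
    hLX.exists_isTopologicalBasis, hL'.exists_isTopologicalBasis⟩
end

section
/- Let X be a topological space and let A ∈ L(X). The identity map from (L(X), τ_w) to (L(X), τ_s) is continuous at A if and only if A is a maximal limit set of X. -/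
open Filter Set Topology TopologicalSpace

universe u v

/-- The largest filter converging to every point of `L`. -/
def limFilter {X : Type u} [TopologicalSpace X] (L : Set X) : Filter X :=
  ⨅ x ∈ L, 𝓝 x

theorem isLimitSet_iff_neBot_limFilter {X : Type u} [TopologicalSpace X] {L : Set X} :
    IsLimitSet L ↔ (limFilter L).NeBot :=
  ⟨fun ⟨_, hF, h⟩ => hF.mono (le_iInf₂ h), fun h => ⟨_, h, fun x hx => iInf₂_le x hx⟩⟩

theorem IsOpen.mem_limFilter {X : Type u} [TopologicalSpace X] {O L : Set X} (hO : IsOpen O)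
    (h : (L ∩ O).Nonempty) : O ∈ limFilter L := by
  obtain ⟨x, hxL, hxO⟩ := h
  exact iInf₂_le (f := fun y (_ : y ∈ L) => 𝓝 y) x hxL (hO.mem_nhds hxO)

theorem IsLimitSet.closure {X : Type u} [TopologicalSpace X] {L : Set X} (h : IsLimitSet L) :
    IsLimitSet (closure L) := by
  refine ⟨limFilter L, isLimitSet_iff_neBot_limFilter.1 h, fun x hx => ?_⟩
  refine (nhds_basis_opens x).ge_iff.2 fun O ⟨hxO, hO⟩ => hO.mem_limFilter ?_
  rw [inter_comm]
  exact mem_closure_iff.1 hx O hO hxO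

theorem isOpen_lowTopL_setOf_meets {X : Type u} [TopologicalSpace X] {O : Set X}
    (hO : IsOpen O) :
    IsOpen[lowTopL X] {B : LX X | ((B : Closeds X) ∩ O : Set X).Nonempty} :=
  (@isOpen_induced_iff _ _ (lowTop X) _ _).2 ⟨{B : Closeds X | ((B : Set X) ∩ O).Nonempty},
    isOpen_generateFrom_of_mem ⟨{O}, by simpa using hO, by simp⟩, rfl⟩

theorem eventually_lowTopL_meets {X : Type u} [TopologicalSpace X] {O : Set X} (hO : IsOpen O)
    {A : LX X} (h : ((A : Closeds X) ∩ O : Set X).Nonempty) :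
    ∀ᶠ B : LX X in @nhds _ (lowTopL X) A, ((B : Closeds X) ∩ O : Set X).Nonempty :=
  @IsOpen.eventually_mem _ (lowTopL X) _ _ (isOpen_lowTopL_setOf_meets hO) h

theorem eventually_lowTopL_mem_limFilter {X : Type u} [TopologicalSpace X] {A : LX X}
    {S : Set X} (hS : S ∈ limFilter ((A : Closeds X) : Set X)) :
    ∀ᶠ B : LX X in @nhds _ (lowTopL X) A, S ∈ limFilter ((B : Closeds X) : Set X) := by
  have key : (@nhds _ (lowTopL X) A).bind (fun B => limFilter ((B : Closeds X) : Set X)) ≤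
      limFilter ((A : Closeds X) : Set X) := by
    refine le_iInf₂ fun a ha => (nhds_basis_opens a).ge_iff.2 fun O ⟨haO, hO⟩ => ?_
    exact mem_bind'.2 <|
      (eventually_lowTopL_meets hO ⟨a, ha, haO⟩).mono fun _ hB => hO.mem_limFilter hB
  exact mem_bind'.1 (key hS)

theorem pure_le_nhds_lowTopL {X : Type u} [TopologicalSpace X] {A B : LX X}
    (h : ((A : Closeds X) : Set X) ⊆ (B : Closeds X)) : pure B ≤ @nhds _ (lowTopL X) A := by
  rw [lowTopL, @nhds_induced _ _ (lowTop X), ← tendsto_iff_comap, lowTop, tendsto_nhds_generateFrom_iff]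
  rintro _ ⟨Φ, -, rfl⟩ hA
  exact fun O hO => (hA O hO).mono (inter_subset_inter_left _ h)

theorem continuousAt_id_lowTopL_fellTopL_iff {X : Type u} [TopologicalSpace X] {A : LX X} :
    @ContinuousAt (LX X) (LX X) (lowTopL X) (fellTopL X) id A ↔
      ∀ C : Set X, IsCompact C → ((A : Closeds X) ∩ C : Set X) = ∅ →
        ∀ᶠ B : LX X in @nhds _ (lowTopL X) A, ((B : Closeds X) ∩ C : Set X) = ∅ := by
  rw [@ContinuousAt.eq_def _ _ (lowTopL X), fellTopL, @nhds_induced _ _ (fellTop X), tendsto_comap_iff, fellTop,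
    tendsto_nhds_generateFrom_iff]
  constructor
  · intro h C hC hAC
    have := h _ ⟨C, ∅, hC, by simp, rfl⟩ ⟨hAC, by simp⟩
    filter_upwards [this] with B hB using hB.1
  · rintro h _ ⟨C, Φ, hC, hΦ, rfl⟩ ⟨hAC, hA⟩
    have hmeet : ∀ᶠ B : LX X in @nhds _ (lowTopL X) A,
        ∀ O ∈ Φ, ((B : Closeds X) ∩ O : Set X).Nonempty :=
      (eventually_all_finset Φ).2 fun O hO => eventually_lowTopL_meets (hΦ O hO) (hA O hO)
    filter_upwards [h C hC hAC, hmeet] with B h₁ h₂ using ⟨h₁, h₂⟩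

theorem IsMaxLimitSet.disjoint_limFilter_nhds {X : Type u} [TopologicalSpace X] {L : Set X}
    (h : IsMaxLimitSet L) {x : X} (hx : x ∉ L) : Disjoint (limFilter L) (𝓝 x) := by
  by_contra hd
  have hlim : IsLimitSet (insert x L) := by
    rw [isLimitSet_iff_neBot_limFilter, limFilter, iInf_insert, inf_comm]
    exact ⟨fun hbot => hd (disjoint_iff.2 hbot)⟩
  exact hx (h.2 _ hlim (subset_insert x L) ▸ mem_insert x L)

/-- the identity map `(L(X), τ_w) → (L(X), τ_s)` is continuous at
`A ∈ L(X)` if and only if `A` is a maximal limit set. -/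
theorem continuousAt_id_iff_isMaxLimitSet {X : Type u} [TopologicalSpace X] (A : LX X) :
    @ContinuousAt (LX X) (LX X) (lowTopL X) (fellTopL X) id A ↔
      IsMaxLimitSet ((A : Closeds X) : Set X) := by
  rw [continuousAt_id_lowTopL_fellTopL_iff]
  constructor
  · refine fun h => ⟨A.2, fun M hM hAM => (Subset.antisymm hAM fun x hxM => ?_).symm⟩
    by_contra hxA
    let B : LX X := ⟨⟨closure M, isClosed_closure⟩, hM.closure⟩
    have hB : (closure M ∩ {x} : Set X) = ∅ :=
      pure_le_nhds_lowTopL (B := B) (hAM.trans subset_closure)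
        (h {x} isCompact_singleton (inter_singleton_eq_empty.2 hxA))
    exact inter_singleton_eq_empty.1 hB (subset_closure hxM)
  · intro hA C hC hAC
    have hdisj : Disjoint (𝓝ˢ C) (limFilter ((A : Closeds X) : Set X)) :=
      hC.disjoint_nhdsSet_left.2 fun x hx =>
        (hA.disjoint_limFilter_nhds fun hxA => hAC.subset ⟨hxA, hx⟩).symm
    obtain ⟨V, ⟨hV, hCV⟩, hVc⟩ := (hasBasis_nhdsSet C).disjoint_iff_left.1 hdisj
    filter_upwards [eventually_lowTopL_mem_limFilter hVc] with B hB
    rw [eq_empty_iff_forall_notMem]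
    rintro b ⟨hbB, hbC⟩
    have := isLimitSet_iff_neBot_limFilter.1 B.2
    exact compl_notMem (hV.mem_limFilter ⟨b, hbB, hCV hbC⟩) hB
end

section
/- For any topological space X, the subspace topologies induced on ML(X) by the lower semifinite topology τ_w and by the Fell topology τ_s coincide. -/
open Filter Set Topology TopologicalSpace

universe u v

/-- A compact set missing a maximal limit set `A` is missed by every limit set that meets
finitely many suitable open sets, each of which meets `A`. -/
theorem IsMaxLimitSet.exists_finset_forall_inter_eq_empty {X : Type u} [TopologicalSpace X]
    {A C : Set X} (hA : IsMaxLimitSet A) (hC : IsCompact C) (hAC : A ∩ C = ∅) :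
    ∃ Φ : Finset (Set X), (∀ O ∈ Φ, IsOpen O ∧ (A ∩ O).Nonempty) ∧
      ∀ B : Set X, IsLimitSet B → (∀ O ∈ Φ, (B ∩ O).Nonempty) → B ∩ C = ∅ := by
  have hle : ∀ a ∈ A, Filter.generate {O | IsOpen O ∧ (A ∩ O).Nonempty} ≤ 𝓝 a := by
    intro a ha s hs
    obtain ⟨t, hts, ht, hat⟩ := mem_nhds_iff.1 hs
    exact mem_of_superset (Filter.mem_generate_of_mem ⟨ht, a, ha, hat⟩) hts
  have hdisj : Disjoint (𝓝ˢ C) (Filter.generate {O | IsOpen O ∧ (A ∩ O).Nonempty}) := by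
    rw [hC.disjoint_nhdsSet_left]
    intro x hx
    by_contra hxA
    have hlim : IsLimitSet (insert x A) :=
      ⟨_, ⟨fun h => hxA (disjoint_iff.2 h)⟩, forall_mem_insert.2
        ⟨inf_le_left, fun a ha => inf_le_right.trans (hle a ha)⟩⟩
    have hmem : x ∈ A := hA.2 _ hlim (subset_insert x A) ▸ mem_insert x A
    exact (hAC ▸ ⟨hmem, hx⟩ : x ∈ (∅ : Set X))
  obtain ⟨V, hV, W, hW, hVW⟩ := Filter.disjoint_iff.1 hdisj
  obtain ⟨t, ht, htfin, htW⟩ := Filter.mem_generate_iff.1 hW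
  refine ⟨htfin.toFinset, fun O hO => ht (htfin.mem_toFinset.1 hO), ?_⟩
  rintro B ⟨F, hF, hFB⟩ hB
  refine eq_empty_of_forall_notMem fun y ⟨hyB, hyC⟩ => ?_
  have hVF : V ∈ F := hFB y hyB (mem_nhdsSet_iff_forall.1 hV y hyC)
  have htF : ⋂₀ t ∈ F := (Filter.sInter_mem htfin).2 fun O hO => by
    obtain ⟨b, hbB, hbO⟩ := hB O (htfin.mem_toFinset.2 hO)
    exact hFB b hbB ((ht hO).1.mem_nhds hbO)
  obtain ⟨z, hzV, hzt⟩ := Filter.nonempty_of_mem (inter_mem hVF htF)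
  exact hVW.le_bot ⟨hzV, htW hzt⟩

/-- the subspace topologies induced on `ML(X)` by `τ_w` and `τ_s` coincide. -/
theorem tauW_eq_tauS_on_ML {X : Type u} [TopologicalSpace X] :
    lowTopML X = fellTopML X := by
  classical
  apply le_antisymm
  · rw [fellTopML, fellTop, induced_generateFrom_eq, le_generateFrom_iff_subset_isOpen]
    rintro _ ⟨_, ⟨C, Φ, hC, hΦ, rfl⟩, rfl⟩
    refine (@isOpen_iff_forall_mem_open (MLX X) (lowTopML X) _).2 ?_
    rintro A ⟨hAC, hAΦ⟩
    obtain ⟨Ψ, hΨ, hB⟩ := A.2.exists_finset_forall_inter_eq_empty hC hAC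
    refine ⟨Subtype.val ⁻¹' {B : Closeds X | ∀ O ∈ Φ ∪ Ψ, ((B : Set X) ∩ O).Nonempty},
      fun B h => ⟨hB _ B.2.1 fun O hO => h O (Finset.mem_union_right _ hO),
        fun O hO => h O (Finset.mem_union_left _ hO)⟩, ?_,
      fun O hO => (Finset.mem_union.1 hO).elim (hAΦ O) fun h => (hΨ O h).2⟩
    exact ⟨_, isOpen_generateFrom_of_mem ⟨Φ ∪ Ψ, fun O hO =>
      (Finset.mem_union.1 hO).elim (hΦ O) fun h => (hΨ O h).1, rfl⟩, rfl⟩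
  · refine induced_mono (le_generateFrom ?_)
    rintro _ ⟨Φ, hΦ, rfl⟩
    exact isOpen_generateFrom_of_mem ⟨∅, Φ, isCompact_empty, hΦ, by simp⟩
end

section
/- Let X be a topological space and A ∈ L(X). Then A is a separated point of the space (L(X), τ_w) (i.e., for every B ∈ L(X) not in the τ_w-closure of {A}, the points A and B have disjoint τ_w-neighbourhoods in L(X)) if and only if A is a maximal limit set of X. -/
open Filter Set Topology TopologicalSpace

universe u v

theorem isLimitSet_iff_neBot {X : Type u} [TopologicalSpace X] {L : Set X} :
    IsLimitSet L ↔ (⨅ x ∈ L, 𝓝 x).NeBot :=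
  ⟨fun ⟨_, hF, h⟩ => hF.mono (le_iInf₂ h), fun h => ⟨_, h, fun _ hx => iInf₂_le _ hx⟩⟩

theorem isOpen_lowTopL_hit {X : Type u} [TopologicalSpace X] {O : Set X} (hO : IsOpen O) :
    IsOpen[lowTopL X] {C : LX X | ((C : Closeds X) ∩ O : Set X).Nonempty} :=
  ⟨_, .basic _ ⟨{O}, by simpa using hO, rfl⟩, by ext; simp⟩

theorem nhds_lowTopL_le_of_subset {X : Type u} [TopologicalSpace X] {A B : LX X}
    (h : ((A : Closeds X) : Set X) ⊆ (B : Closeds X)) :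
    @nhds _ (lowTopL X) B ≤ @nhds _ (lowTopL X) A := by
  rw [lowTopL, @nhds_induced _ _ (lowTop X), @nhds_induced _ _ (lowTop X), lowTop,
    nhds_generateFrom, nhds_generateFrom]
  refine comap_mono (le_iInf₂ ?_)
  rintro _ ⟨hA, Φ, hΦ, rfl⟩
  exact iInf₂_le _ ⟨fun O hO => (hA O hO).mono (inter_subset_inter_left _ h), Φ, hΦ, rfl⟩

theorem subset_of_mem_closure_lowTopL {X : Type u} [TopologicalSpace X] {A B : LX X}
    (h : B ∈ @closure _ (lowTopL X) {A}) :
    ((B : Closeds X) : Set X) ⊆ (A : Closeds X) := by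
  let _ := lowTopL X
  intro x hx
  rw [← (A : Closeds X).isClosed.closure_eq]
  refine mem_closure_iff.2 fun O hO hxO => ?_
  obtain ⟨C, hC, rfl⟩ := mem_closure_iff.1 h _ (isOpen_lowTopL_hit hO) ⟨x, hx, hxO⟩
  rwa [inter_comm]

theorem bind_nhds_lowTopL_le {X : Type u} [TopologicalSpace X] (A : LX X) :
    ((@nhds _ (lowTopL X) A).bind fun C => ⨅ x ∈ ((C : Closeds X) : Set X), 𝓝 x) ≤
      ⨅ x ∈ ((A : Closeds X) : Set X), 𝓝 x := by
  let _ := lowTopL X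
  refine le_iInf₂ fun x hx => (nhds_basis_opens x).ge_iff.2 fun O ⟨hxO, hO⟩ => ?_
  rw [mem_bind']
  filter_upwards [(isOpen_lowTopL_hit hO).mem_nhds ⟨x, hx, hxO⟩] with C ⟨y, hyC, hyO⟩
  exact (iInf₂_le y hyC : _ ≤ 𝓝 y) (hO.mem_nhds hyO)

/-- `A ∈ L(X)` is a separated point of `(L(X), τ_w)` if and only if `A`
is a maximal limit set of `X`. -/
theorem separatedPt_iff_isMaxLimitSet {X : Type u} [TopologicalSpace X] (A : LX X) :
    @IsSeparatedPt (LX X) (lowTopL X) A ↔ IsMaxLimitSet ((A : Closeds X) : Set X) := by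
  let _ := lowTopL X
  constructor
  · refine fun hA => ⟨A.2, fun M hM hAM => hAM.antisymm' ?_⟩
    let B : LX X := ⟨⟨closure M, isClosed_closure⟩, hM.closure⟩
    by_contra hMA
    obtain ⟨U, hU, V, hV, hUV⟩ := hA B fun hB =>
      hMA (subset_closure.trans (subset_of_mem_closure_lowTopL hB))
    have hAB : 𝓝 B ≤ 𝓝 A := nhds_lowTopL_le_of_subset (hAM.trans subset_closure)
    exact hUV.le_bot ⟨mem_of_mem_nhds (hAB hU), mem_of_mem_nhds hV⟩
  · intro hA B hB
    have hBA : ¬ ((B : Closeds X) : Set X) ⊆ (A : Closeds X) := fun h =>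
      hB <| mem_closure_iff_nhds.2 fun U hU =>
        ⟨A, mem_of_mem_nhds (nhds_lowTopL_le_of_subset h hU), rfl⟩
    have hAB : ¬ IsLimitSet ((A : Closeds X) ∪ (B : Closeds X) : Set X) := fun h =>
      hBA (union_eq_left.1 (hA.2 _ h subset_union_left))
    rw [isLimitSet_iff_neBot, iInf_union, not_neBot, ← disjoint_iff,
      Filter.disjoint_iff] at hAB
    obtain ⟨S, hS, T, hT, hST⟩ := hAB
    refine ⟨_, mem_bind'.1 (bind_nhds_lowTopL_le A hS), _,
      mem_bind'.1 (bind_nhds_lowTopL_le B hT), Set.disjoint_left.2 fun C hCS hCT => ?_⟩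
    have := isLimitSet_iff_neBot.1 C.2
    exact this.ne (disjoint_self.1 (Filter.disjoint_iff.2 ⟨S, hCS, T, hCT, hST⟩))
end

section
/- If X is a second countable, locally compact Baire topological space, then the family { closure({x}) : x is a separated point of X } is dense in ML(X) (with the subspace topology induced by τ_w). -/
open Filter Set Topology TopologicalSpace

universe u v

/-- In a second countable Baire space the separated points are dense: every point outside the
frontiers of all members of a countable basis is separated. -/
theorem dense_isSeparatedPt {X : Type u} [TopologicalSpace X] [SecondCountableTopology X]
    [BaireSpace X] : Dense {x : X | IsSeparatedPt x} := by
  have hd : Dense (⋂ V ∈ countableBasis X, (frontier V)ᶜ) := by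
    refine dense_biInter_of_isOpen (fun V _ => isClosed_frontier.isOpen_compl)
      (countable_countableBasis X) fun V hV => ?_
    rw [← interior_eq_empty_iff_dense_compl]
    rw [← frontier_compl]
    exact interior_frontier (isOpen_of_mem_countableBasis hV).isClosed_compl
  refine hd.mono fun x hx z hz => ?_
  obtain ⟨V, hV, hzV, hsub⟩ :=
    (isBasis_countableBasis X).exists_subset_of_mem_open hz isClosed_closure.isOpen_compl
  have hVo := isOpen_of_mem_countableBasis hV
  have hxV : x ∉ V := fun h => hsub h (subset_closure rfl)
  have hxcl : x ∉ closure V := fun h =>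
    mem_iInter₂.1 hx V hV (by rw [hVo.frontier_eq]; exact ⟨h, hxV⟩)
  exact ⟨(closure V)ᶜ, isClosed_closure.isOpen_compl.mem_nhds hxcl, V, hVo.mem_nhds hzV,
    disjoint_compl_left.mono_right subset_closure⟩

theorem IsSeparatedPt.isMaxLimitSet_closure {X : Type u} [TopologicalSpace X] {x : X}
    (hx : IsSeparatedPt x) : IsMaxLimitSet (closure {x}) := by
  refine ⟨⟨𝓝 x, inferInstance, fun y hy => specializes_iff_mem_closure.2 hy⟩, ?_⟩
  rintro M ⟨F, hF, hM⟩ hsub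
  refine Subset.antisymm (fun z hz => ?_) hsub
  by_contra hzx
  obtain ⟨U, hU, V, hV, hUV⟩ := hx z hzx
  have h := inter_mem (hM x (hsub (subset_closure rfl)) hU) (hM z hz hV)
  rw [hUV.inter_eq] at h
  exact hF.ne (empty_mem_iff_bot.1 h)

/-- If a filter converges to every point of `A`, then each `τ_w`-neighbourhood of `A` contains the
closures of all points of some open member of the filter. -/
theorem exists_isOpen_mem_closure_singleton_mem {X : Type u} [TopologicalSpace X] {A : Closeds X}
    {F : Filter X} (hF : ∀ x ∈ (A : Set X), F ≤ 𝓝 x) {W : Set (Closeds X)}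
    (hW : IsOpen[lowTop X] W) (hA : A ∈ W) :
    ∃ O ∈ F, IsOpen O ∧ ∀ x ∈ O, Closeds.closure {x} ∈ W := by
  induction hW with
  | basic W hW =>
    obtain ⟨Φ, hΦ, rfl⟩ := hW
    refine ⟨⋂ O ∈ Φ, O, (biInter_finset_mem Φ).2 fun O hO => ?_,
      isOpen_biInter_finset hΦ, fun x hx O hO => ⟨x, subset_closure rfl, mem_iInter₂.1 hx O hO⟩⟩
    obtain ⟨a, ha, haO⟩ := hA O hO
    exact hF a ha ((hΦ O hO).mem_nhds haO)
  | univ => exact ⟨univ, univ_mem, isOpen_univ, fun _ _ => trivial⟩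
  | inter _ _ _ _ ih₁ ih₂ =>
    obtain ⟨O₁, hO₁, ho₁, h₁⟩ := ih₁ hA.1
    obtain ⟨O₂, hO₂, ho₂, h₂⟩ := ih₂ hA.2
    exact ⟨O₁ ∩ O₂, inter_mem hO₁ hO₂, ho₁.inter ho₂, fun x hx => ⟨h₁ x hx.1, h₂ x hx.2⟩⟩
  | sUnion S _ ih =>
    obtain ⟨W, hW, hAW⟩ := hA
    obtain ⟨O, hO, ho, h⟩ := ih W hW hAW
    exact ⟨O, hO, ho, fun x hx => ⟨W, hW, h x hx⟩⟩


/-- if `X` is a second countable locally compact Baire space then the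
family `{closure {x} : x separated in X}` is dense in `(ML(X), τ_w)`. -/
theorem dense_separated_closures_in_ML {X : Type u} [TopologicalSpace X]
    [SecondCountableTopology X] [LocallyCompactSpace X] [BaireSpace X] :
    @Dense (MLX X) (lowTopML X)
      {A : MLX X | ∃ x : X, IsSeparatedPt x ∧ ((A : Closeds X) : Set X) = closure {x}} := by
  let := lowTopML X
  refine dense_iff_inter_open.2 ?_
  rintro _ ⟨W, hW, rfl⟩ ⟨A, hAW⟩
  obtain ⟨F, hF, hFA⟩ := A.2.1
  obtain ⟨O, hOF, hO, hOW⟩ := exists_isOpen_mem_closure_singleton_mem hFA hW hAW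
  obtain ⟨x, hxO, hx⟩ := dense_isSeparatedPt.inter_open_nonempty O hO (hF.nonempty_of_mem hOF)
  exact ⟨⟨Closeds.closure {x}, hx.isMaxLimitSet_closure⟩, hOW x hxO, x, hx, rfl⟩
end

section
/- If X is a second countable locally compact topological space, then ML(X) is a G_δ subset of (L(X), τ_s). -/
open Filter Set Topology TopologicalSpace

universe u v

theorem IsMaxLimitSet.disjoint_nhds {X : Type u} [TopologicalSpace X] {L : Set X}
    (hL : IsMaxLimitSet L) {x : X} (hx : x ∉ L) : Disjoint (𝓝 x) (⨅ y ∈ L, 𝓝 y) := by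
  by_contra h
  rw [disjoint_iff, ← ne_eq, ← neBot_iff] at h
  have hins : IsLimitSet (insert x L) := by
    refine ⟨_, h, ?_⟩
    rintro y (rfl | hy)
    · exact inf_le_left
    · exact inf_le_right.trans (iInf₂_le y hy)
  exact hx (hL.2 _ hins (subset_insert x L) ▸ mem_insert x L)

/-- A closed limit set is maximal iff its common neighbourhoods can be separated from small
basic open sets inside its complement. -/
theorem isMaxLimitSet_iff_of_isTopologicalBasis {X : Type u} [TopologicalSpace X]
    [LocallyCompactSpace X] {B : Set (Set X)} (hB : IsTopologicalBasis B) {L : Set X}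
    (hc : IsClosed L) (hl : IsLimitSet L) :
    IsMaxLimitSet L ↔ ∀ V ∈ B, ∀ W ∈ B, (∃ K, IsCompact K ∧ V ⊆ K ∧ K ⊆ W) →
      (L ∩ W).Nonempty ∨ Vᶜ ∈ ⨅ x ∈ L, 𝓝 x := by
  constructor
  · rintro hL V - W - ⟨K, hK, hVK, hKW⟩
    refine or_iff_not_imp_left.2 fun hLW ↦ ?_
    have hdisj : Disjoint (𝓝ˢ K) (⨅ x ∈ L, 𝓝 x) :=
      hK.disjoint_nhdsSet_left.2 fun x hx ↦ hL.disjoint_nhds fun hxL ↦ hLW ⟨x, hxL, hKW hx⟩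
    obtain ⟨S, hS, T, hT, hST⟩ := Filter.disjoint_iff.1 hdisj
    exact mem_of_superset hT fun y hyT hyV ↦
      disjoint_left.1 hST (subset_of_mem_nhdsSet hS (hVK hyV)) hyT
  · intro h
    refine ⟨hl, fun M ⟨F, hF, hFM⟩ hLM ↦ Subset.antisymm (fun x hx ↦ ?_) hLM⟩
    by_contra hxL
    obtain ⟨W, hW, hxW, hWL⟩ := hB.mem_nhds_iff.1 (hc.isOpen_compl.mem_nhds hxL)
    obtain ⟨K, hKx, hKW, hK⟩ := local_compact_nhds ((hB.isOpen hW).mem_nhds hxW)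
    obtain ⟨V, hV, hxV, hVK⟩ := hB.mem_nhds_iff.1 hKx
    rcases h V hV W hW ⟨K, hK, hVK, hKW⟩ with ⟨y, hyL, hyW⟩ | hVc
    · exact hWL hyW hyL
    · have hVF : V ∈ F := hFM x hx ((hB.isOpen hV).mem_nhds hxV)
      exact compl_notMem hVF ((le_iInf₂ fun y hy ↦ hFM y (hLM hy)) hVc)

theorem isOpen_fellTop_inter_nonempty {X : Type u} [TopologicalSpace X] {Φ : Finset (Set X)}
    (hΦ : ∀ O ∈ Φ, IsOpen O) :
    IsOpen[fellTop X] {A : Closeds X | ∀ O ∈ Φ, ((A : Set X) ∩ O).Nonempty} :=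
  isOpen_generateFrom_of_mem ⟨∅, Φ, isCompact_empty, hΦ, by simp⟩

theorem isOpen_fellTop_mem_iInf_nhds {X : Type u} [TopologicalSpace X] (S : Set X) :
    IsOpen[fellTop X] {A : Closeds X | S ∈ ⨅ x ∈ (A : Set X), 𝓝 x} := by
  classical
  let _ := fellTop X
  refine isOpen_iff_forall_mem_open.2 fun A hA ↦ ?_
  rw [mem_ofPred_eq, iInf_subtype', Filter.mem_iInf'] at hA
  obtain ⟨I, hI, V, hV, -, hS, -⟩ := hA
  refine ⟨_, ?_, isOpen_fellTop_inter_nonempty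
    (Φ := hI.toFinset.image fun i ↦ interior (V i)) ?_, ?_⟩
  · intro C hC
    rw [mem_ofPred_eq, hS]
    refine (biInter_mem hI).2 fun i hi ↦ ?_
    obtain ⟨y, hyC, hy⟩ := hC _ (Finset.mem_image_of_mem _ (hI.mem_toFinset.2 hi))
    exact iInf₂_le (f := fun x (_ : x ∈ (C : Set X)) ↦ 𝓝 x) y hyC (mem_interior_iff_mem_nhds.1 hy)
  · simp only [Finset.forall_mem_image]
    exact fun _ _ ↦ isOpen_interior
  · simp only [mem_ofPred_eq, Finset.forall_mem_image]
    exact fun i _ ↦ ⟨i, i.2, mem_interior_iff_mem_nhds.2 (hV i)⟩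

/-- if `X` is second countable and locally compact then `ML(X)` is a
`G_δ` subset of `(L(X), τ_s)`. -/
theorem ML_isGδ_in_L {X : Type u} [TopologicalSpace X] [SecondCountableTopology X]
    [LocallyCompactSpace X] :
    @IsGδ (LX X) (fellTopL X) {A : LX X | IsMaxLimitSet ((A : Closeds X) : Set X)} := by
  let _ : TopologicalSpace (Closeds X) := fellTop X
  let _ : TopologicalSpace (LX X) := fellTopL X
  have hcont : Continuous (Subtype.val : LX X → Closeds X) := continuous_induced_dom
  have hB := isBasis_countableBasis X
  have hcount := countable_countableBasis X
  have key : {A : LX X | IsMaxLimitSet ((A : Closeds X) : Set X)} =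
      ⋂ V ∈ countableBasis X, ⋂ W ∈ countableBasis X,
        ⋂ _ : ∃ K, IsCompact K ∧ V ⊆ K ∧ K ⊆ W, Subtype.val ⁻¹'
          ({A : Closeds X | ((A : Set X) ∩ W).Nonempty} ∪
            {A : Closeds X | Vᶜ ∈ ⨅ x ∈ (A : Set X), 𝓝 x}) := by
    ext A
    simp only [mem_iInter]
    exact isMaxLimitSet_iff_of_isTopologicalBasis hB A.1.isClosed A.2
  rw [key]
  refine IsGδ.biInter hcount fun V _ ↦ IsGδ.biInter hcount fun W hW ↦ IsGδ.iInter fun _ ↦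
    (IsOpen.preimage hcont (IsOpen.union ?_ (isOpen_fellTop_mem_iInf_nhds Vᶜ))).isGδ
  simpa using isOpen_fellTop_inter_nonempty (Φ := {W}) (by simpa using hB.isOpen hW)
end

section
/- Let X be a second countable locally compact topological space in which every closed subset is a Baire space. Then the set { closure({x}) : x is a separated point of X } is a G_δ subset of L(X) (with the Fell topology τ_s) and is a dense subset of ML(X). -/
open Filter Set Topology TopologicalSpace

universe u v

section CountableFamilies

variable {X : Type u} [TopologicalSpace X] [SecondCountableTopology X]

theorem exists_countable_isCompact_nhds [LocallyCompactSpace X] :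
    ∃ 𝒞 : Set (Set X), 𝒞.Countable ∧ (∀ C ∈ 𝒞, IsCompact C) ∧
      ∀ x, ∀ U ∈ 𝓝 x, ∃ C ∈ 𝒞, C ∈ 𝓝 x ∧ C ⊆ U := by
  have hK : ∀ p : Set X × Set X, ∃ K : Set X, IsCompact K ∧
      ((∃ K', IsCompact K' ∧ p.1 ⊆ K' ∧ K' ⊆ p.2) → p.1 ⊆ K ∧ K ⊆ p.2) := by
    intro p
    by_cases h : ∃ K', IsCompact K' ∧ p.1 ⊆ K' ∧ K' ⊆ p.2
    · obtain ⟨K, hK, h₁, h₂⟩ := h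
      exact ⟨K, hK, fun _ => ⟨h₁, h₂⟩⟩
    · exact ⟨∅, isCompact_empty, fun h' => absurd h' h⟩
  choose K hKc hK using hK
  have hB := isBasis_countableBasis X
  refine ⟨K '' (countableBasis X ×ˢ countableBasis X),
    ((countable_countableBasis X).prod (countable_countableBasis X)).image K, ?_, ?_⟩
  · rintro _ ⟨p, -, rfl⟩
    exact hKc p
  · intro x U hU
    obtain ⟨V, hV, hxV, hVU⟩ := hB.mem_nhds_iff.1 hU
    obtain ⟨L, hL, hLV, hLc⟩ := local_compact_nhds ((hB.isOpen hV).mem_nhds hxV)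
    obtain ⟨W, hW, hxW, hWL⟩ := hB.mem_nhds_iff.1 hL
    obtain ⟨h₁, h₂⟩ := hK (W, V) ⟨L, hLc, hWL, hLV⟩
    exact ⟨K (W, V), ⟨_, ⟨hW, hV⟩, rfl⟩,
      mem_of_superset ((hB.isOpen hW).mem_nhds hxW) h₁, h₂.trans hVU⟩

variable (X) in
theorem exists_countable_isOpen_between_isCompact :
    ∃ 𝒲 : Set (Set X), 𝒲.Countable ∧ (∀ W ∈ 𝒲, IsOpen W) ∧
      ∀ K U, IsCompact K → IsOpen U → K ⊆ U → ∃ W ∈ 𝒲, K ⊆ W ∧ W ⊆ U := by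
  have hB := isBasis_countableBasis X
  refine ⟨sUnion '' {s | s.Finite ∧ s ⊆ countableBasis X},
    (countable_ofPred_finite_subset (countable_countableBasis X)).image _, ?_, ?_⟩
  · rintro _ ⟨s, ⟨-, hs⟩, rfl⟩
    exact isOpen_sUnion fun t ht => hB.isOpen (hs ht)
  · intro K U hK hU hKU
    suffices ∃ s : Set (Set X), s.Finite ∧ s ⊆ countableBasis X ∧ K ⊆ ⋃₀ s ∧ ⋃₀ s ⊆ U by
      obtain ⟨s, hs, hsB, h⟩ := this
      exact ⟨_, ⟨s, ⟨hs, hsB⟩, rfl⟩, h⟩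
    refine hK.induction_on ⟨∅, by simp⟩ ?_ ?_ ?_
    · rintro s t hst ⟨f, hf, hfB, htf, hfU⟩
      exact ⟨f, hf, hfB, hst.trans htf, hfU⟩
    · rintro s t ⟨f, hf, hfB, hsf, hfU⟩ ⟨g, hg, hgB, htg, hgU⟩
      refine ⟨f ∪ g, hf.union hg, union_subset hfB hgB, ?_, ?_⟩ <;> rw [sUnion_union]
      · exact union_subset_union hsf htg
      · exact union_subset hfU hgU
    · intro x hx
      obtain ⟨V, hV, hxV, hVU⟩ := hB.exists_subset_of_mem_open (hKU hx) hU
      exact ⟨V, mem_nhdsWithin_of_mem_nhds ((hB.isOpen hV).mem_nhds hxV),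
        {V}, by simpa using ⟨hV, hVU⟩⟩

/-- In a second countable space, a closed irreducible Baire subspace has a generic point. -/
theorem IsIrreducible.exists_eq_closure_singleton {A : Set X} (hA : IsIrreducible A)
    (hc : IsClosed A) [BaireSpace A] : ∃ x, A = closure {x} := by
  have hB := isBasis_countableBasis X
  have : Nonempty A := hA.nonempty.to_subtype
  have hd : Dense (⋂ U ∈ {U ∈ countableBasis X | (A ∩ U).Nonempty},
      ((↑) : A → X) ⁻¹' U) := by
    refine dense_biInter_of_isOpen (fun U hU => (hB.isOpen hU.1).preimage continuous_subtype_val)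
      ((countable_countableBasis X).mono (sep_subset _ _)) fun U hU => ?_
    rw [dense_iff_inter_open]
    rintro _ ⟨V, hV, rfl⟩ ⟨a, ha⟩
    obtain ⟨b, hb, hbV, hbU⟩ := hA.isPreirreducible V U hV (hB.isOpen hU.1) ⟨a, a.2, ha⟩ hU.2
    exact ⟨⟨b, hb⟩, hbV, hbU⟩
  obtain ⟨x, hx⟩ := hd.nonempty
  refine ⟨x, Subset.antisymm (fun y hy => ?_) (hc.closure_subset_iff.2 (by simp))⟩
  rw [hB.mem_closure_iff]
  intro U hU hyU
  exact ⟨x, mem_iInter₂.1 hx U ⟨hU, y, hy, hyU⟩, rfl⟩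

end CountableFamilies

section SeparatedPoints

variable {X : Type u} [TopologicalSpace X]

theorem isSeparatedPt_of_forall_compact {𝒞 : Set (Set X)}
    (h𝒞 : ∀ x, ∀ U ∈ 𝓝 x, ∃ C ∈ 𝒞, C ∈ 𝓝 x ∧ C ⊆ U) {x : X}
    (hx : ∀ C ∈ 𝒞, (closure {x} ∩ C).Nonempty ∨ x ∈ interior Cᶜ) : IsSeparatedPt x := by
  intro z hz
  obtain ⟨C, hC, hzC, hCx⟩ := h𝒞 z _ (isClosed_closure.isOpen_compl.mem_nhds hz)
  rcases hx C hC with ⟨y, hy, hyC⟩ | h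
  · exact absurd hy (hCx hyC)
  · exact ⟨_, isOpen_interior.mem_nhds h, C, hzC,
      disjoint_compl_left.mono_left interior_subset⟩

theorem IsSeparatedPt.mem_interior_compl {x : X} (hx : IsSeparatedPt x) {C : Set X}
    (hC : IsCompact C) (hxC : Disjoint (closure {x}) C) : x ∈ interior Cᶜ := by
  have h : Disjoint (𝓝ˢ C) (𝓝 x) := by
    rw [hC.disjoint_nhdsSet_left]
    intro z hz
    obtain ⟨U, hU, V, hV, hUV⟩ := hx z fun h => hxC.notMem_of_mem_left h hz
    exact Filter.disjoint_iff.2 ⟨V, hV, U, hU, hUV.symm⟩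
  obtain ⟨V, hV, U, hU, hVU⟩ := Filter.disjoint_iff.1 h
  rw [mem_interior_iff_mem_nhds]
  exact mem_of_superset hU (hVU.mono_left (subset_of_mem_nhdsSet hV)).subset_compl_left

theorem IsSeparatedPt.isMaxLimitSet {x : X} (hx : IsSeparatedPt x) :
    IsMaxLimitSet (closure {x}) := by
  refine ⟨⟨𝓝 x, inferInstance, fun y hy => specializes_iff_mem_closure.2 hy⟩, ?_⟩
  rintro M ⟨F, hF, hFM⟩ hM
  refine (hM.antisymm fun z hz => ?_).symm
  by_contra hzx
  obtain ⟨U, hU, V, hV, hUV⟩ := hx z hzx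
  exact hF.ne (Filter.empty_mem_iff_bot.1 <| hUV.inter_eq ▸
    inter_mem (hFM x (hM (subset_closure rfl)) hU) (hFM z hz hV))

theorem dense_setOf_isSeparatedPt [SecondCountableTopology X] [LocallyCompactSpace X]
    [BaireSpace X] : Dense {x : X | IsSeparatedPt x} := by
  obtain ⟨𝒞, h𝒞, h𝒞c, h𝒞n⟩ := exists_countable_isCompact_nhds (X := X)
  obtain ⟨𝒲, h𝒲, h𝒲o, h𝒲K⟩ := exists_countable_isOpen_between_isCompact X
  have hd : Dense (⋂ p ∈ {p ∈ 𝒞 ×ˢ 𝒲 | p.1 ⊆ p.2}, p.2 ∪ interior p.1ᶜ) := by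
    refine dense_biInter_of_isOpen (fun p hp => (h𝒲o _ hp.1.2).union isOpen_interior)
      ((h𝒞.prod h𝒲).mono (sep_subset _ _)) fun p hp => ?_
    rw [interior_compl, dense_iff_closure_eq, closure_union, eq_univ_iff_forall]
    intro x
    by_cases hx : x ∈ closure p.1
    · exact .inl (closure_mono hp.2 hx)
    · exact .inr (subset_closure hx)
  refine hd.mono fun x hx => isSeparatedPt_of_forall_compact h𝒞n fun C hC => ?_
  by_contra! h
  obtain ⟨W, hW, hCW, hWx⟩ := h𝒲K C (closure {x})ᶜ (h𝒞c C hC) isClosed_closure.isOpen_compl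
    (disjoint_iff_inter_eq_empty.2 h.1).subset_compl_left
  rcases mem_iInter₂.1 hx (C, W) ⟨⟨hC, hW⟩, hCW⟩ with hxW | hxC
  · exact hWx hxW (subset_closure rfl)
  · exact h.2 hxC

end SeparatedPoints

section MaximalLimitSets

variable {X : Type u} [TopologicalSpace X]

theorem isLimitSet_iff_neBot_iInf {A : Set X} :
    IsLimitSet A ↔ (⨅ a : A, 𝓝 (a : X)).NeBot := by
  refine ⟨?_, fun h => ⟨_, h, fun x hx => iInf_le (fun a : A => 𝓝 (a : X)) ⟨x, hx⟩⟩⟩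
  rintro ⟨F, hF, hFA⟩
  exact hF.mono (le_iInf fun a => hFA a a.2)

theorem interior_mem_iInf_nhds {ι : Type*} {f : ι → X} {s : Set X} (hs : s ∈ ⨅ i, 𝓝 (f i)) :
    interior s ∈ ⨅ i, 𝓝 (f i) := by
  refine Filter.iInf_sets_induct (p := fun s => interior s ∈ ⨅ i, 𝓝 (f i)) hs (by simp) ?_
  intro i s t hs ht
  rw [interior_inter]
  exact inter_mem (mem_iInf_of_mem i (interior_mem_nhds.2 hs)) ht

theorem IsMaxLimitSet.disjoint_iInf_nhds {A : Set X} (hA : IsMaxLimitSet A) {z : X} (hz : z ∉ A) :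
    Disjoint (𝓝 z) (⨅ a : A, 𝓝 (a : X)) := by
  rw [disjoint_iff]
  by_contra h
  refine hz (hA.2 (insert z A) ⟨_, ⟨h⟩, ?_⟩ (subset_insert z A) ▸ mem_insert z A)
  rintro x (rfl | hx)
  · exact inf_le_left
  · exact inf_le_right.trans (iInf_le (fun a : A => 𝓝 (a : X)) ⟨x, hx⟩)

/-- The closures of the points of a nonempty open set can be kept inside a basic Fell neighbourhood
of a maximal limit set. -/
theorem IsMaxLimitSet.exists_isOpen_closure {A : Set X} (hA : IsMaxLimitSet A) {C : Set X}
    (hC : IsCompact C) (hAC : Disjoint A C) {Φ : Finset (Set X)} (hΦ : ∀ O ∈ Φ, IsOpen O)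
    (hAΦ : ∀ O ∈ Φ, (A ∩ O).Nonempty) :
    ∃ W : Set X, IsOpen W ∧ W.Nonempty ∧
      ∀ x ∈ W, Disjoint (closure {x}) C ∧ ∀ O ∈ Φ, (closure {x} ∩ O).Nonempty := by
  have hne := isLimitSet_iff_neBot_iInf.1 hA.1
  have hdisj : Disjoint (𝓝ˢ C) (⨅ a : A, 𝓝 (a : X)) :=
    hC.disjoint_nhdsSet_left.2 fun z hz => hA.disjoint_iInf_nhds (hAC.notMem_of_mem_right hz)
  obtain ⟨V, hV, P, hP, hVP⟩ := Filter.disjoint_iff.1 hdisj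
  obtain ⟨V', hV'o, hCV', hV'V⟩ := mem_nhdsSet_iff_exists.1 hV
  have hΦmem : (⋂ O ∈ Φ, O) ∈ ⨅ a : A, 𝓝 (a : X) := by
    refine (biInter_finset_mem Φ).2 fun O hO => ?_
    obtain ⟨a, ha, haO⟩ := hAΦ O hO
    exact mem_iInf_of_mem ⟨a, ha⟩ ((hΦ O hO).mem_nhds haO)
  have hmem := inter_mem (interior_mem_iInf_nhds hP) hΦmem
  refine ⟨_, isOpen_interior.inter (isOpen_biInter_finset hΦ), nonempty_of_mem hmem, ?_⟩
  rintro x ⟨hxP, hxΦ⟩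
  refine ⟨?_, fun O hO => ⟨x, subset_closure rfl, mem_iInter₂.1 hxΦ O hO⟩⟩
  have hxV' : x ∉ V' := fun h => hVP.notMem_of_mem_left (hV'V h) (interior_subset hxP)
  exact (Disjoint.closure_left (disjoint_singleton_left.2 hxV') hV'o).mono_right hCV'

end MaximalLimitSets

section FellTopology

variable {X : Type u} [TopologicalSpace X]

theorem isTopologicalBasis_fellTop :
    @IsTopologicalBasis (Closeds X) (fellTop X)
      {U | ∃ (C : Set X) (Φ : Finset (Set X)), IsCompact C ∧ (∀ O ∈ Φ, IsOpen O) ∧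
        U = {A : Closeds X | (A : Set X) ∩ C = ∅ ∧ ∀ O ∈ Φ, ((A : Set X) ∩ O).Nonempty}} := by
  classical
  let := fellTop X
  refine ⟨?_, ?_, rfl⟩
  · rintro _ ⟨C, Φ, hC, hΦ, rfl⟩ _ ⟨D, Ψ, hD, hΨ, rfl⟩ A ⟨⟨hAC, hAΦ⟩, hAD, hAΨ⟩
    refine ⟨_, ⟨C ∪ D, Φ ∪ Ψ, hC.union hD, ?_, rfl⟩, ⟨?_, ?_⟩, ?_⟩
    · exact fun O hO => (Finset.mem_union.1 hO).elim (hΦ O) (hΨ O)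
    · rw [inter_union_distrib_left, hAC, hAD, union_empty]
    · exact fun O hO => (Finset.mem_union.1 hO).elim (hAΦ O) (hAΨ O)
    · rintro B ⟨hB, hB'⟩
      rw [inter_union_distrib_left, union_empty_iff] at hB
      exact ⟨⟨hB.1, fun O hO => hB' O (Finset.mem_union_left _ hO)⟩,
        hB.2, fun O hO => hB' O (Finset.mem_union_right _ hO)⟩
  · exact eq_univ_of_forall fun A => ⟨_, ⟨∅, ∅, isCompact_empty, by simp, rfl⟩, by simp⟩

theorem isOpen_fellTop_setOf_inter_nonempty {U : Set X} (hU : IsOpen U) :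
    IsOpen[fellTop X] {A : Closeds X | ((A : Set X) ∩ U).Nonempty} :=
  isOpen_generateFrom_of_mem ⟨∅, {U}, isCompact_empty, by simpa using hU, by simp⟩

theorem isOpen_fellTop_setOf_inter_eq_empty {C : Set X} (hC : IsCompact C) :
    IsOpen[fellTop X] {A : Closeds X | (A : Set X) ∩ C = ∅} :=
  isOpen_generateFrom_of_mem ⟨C, ∅, hC, by simp, by simp⟩

variable [SecondCountableTopology X]

theorem isGδ_fellTop_setOf_inter_isCompact_nonempty {C : Set X} (hC : IsCompact C) :
    @IsGδ (Closeds X) (fellTop X) {A : Closeds X | ((A : Set X) ∩ C).Nonempty} := by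
  let := fellTop X
  obtain ⟨𝒲, h𝒲, h𝒲o, h𝒲K⟩ := exists_countable_isOpen_between_isCompact X
  have h : {A : Closeds X | ((A : Set X) ∩ C).Nonempty} =
      ⋂ W ∈ {W ∈ 𝒲 | C ⊆ W}, {A : Closeds X | ((A : Set X) ∩ W).Nonempty} := by
    ext A
    simp only [mem_ofPred_eq, mem_iInter]
    refine ⟨fun h W hW => h.mono (inter_subset_inter_right _ hW.2), fun h => ?_⟩
    by_contra! hAC
    obtain ⟨W, hW, hCW, hWA⟩ := h𝒲K C (A : Set X)ᶜ hC A.isClosed.isOpen_compl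
      (disjoint_iff_inter_eq_empty.2 hAC).subset_compl_left
    obtain ⟨y, hyA, hyW⟩ := h W ⟨hW, hCW⟩
    exact hWA hyW hyA
  rw [h]
  exact .biInter_of_isOpen (h𝒲.mono (sep_subset _ _)) fun W hW =>
    isOpen_fellTop_setOf_inter_nonempty (h𝒲o W hW.1)

variable [LocallyCompactSpace X]

theorem isGδ_fellTop_setOf_inter_isOpen_eq_empty {U : Set X} (hU : IsOpen U) :
    @IsGδ (Closeds X) (fellTop X) {A : Closeds X | (A : Set X) ∩ U = ∅} := by
  let := fellTop X
  obtain ⟨𝒞, h𝒞, h𝒞c, h𝒞n⟩ := exists_countable_isCompact_nhds (X := X)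
  have h : {A : Closeds X | (A : Set X) ∩ U = ∅} =
      ⋂ C ∈ {C ∈ 𝒞 | C ⊆ U}, {A : Closeds X | (A : Set X) ∩ C = ∅} := by
    ext A
    simp only [mem_ofPred_eq, mem_iInter]
    refine ⟨fun h C hC => subset_empty_iff.1 (h ▸ inter_subset_inter_right _ hC.2), fun h => ?_⟩
    refine eq_empty_of_forall_notMem fun x hx => ?_
    obtain ⟨C, hC, hxC, hCU⟩ := h𝒞n x U (hU.mem_nhds hx.2)
    exact (h C ⟨hC, hCU⟩).subset ⟨hx.1, mem_of_mem_nhds hxC⟩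
  rw [h]
  exact .biInter_of_isOpen (h𝒞.mono (sep_subset _ _)) fun C hC =>
    isOpen_fellTop_setOf_inter_eq_empty (h𝒞c C hC.1)

theorem isGδ_fellTop_setOf_isPreirreducible :
    @IsGδ (Closeds X) (fellTop X) {A : Closeds X | IsPreirreducible (A : Set X)} := by
  let := fellTop X
  have hB := isBasis_countableBasis X
  have h : {A : Closeds X | IsPreirreducible (A : Set X)} =
      ⋂ U ∈ countableBasis X, ⋂ V ∈ countableBasis X,
        ({A : Closeds X | (A : Set X) ∩ U = ∅} ∪ {A : Closeds X | (A : Set X) ∩ V = ∅}) ∪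
          {A : Closeds X | ((A : Set X) ∩ (U ∩ V)).Nonempty} := by
    ext A
    simp only [mem_ofPred_eq, mem_iInter, mem_union]
    constructor
    · intro h U hU V hV
      by_contra! h'
      exact (h U V (hB.isOpen hU) (hB.isOpen hV) h'.1.1 h'.1.2).ne_empty h'.2
    · rintro h U V hU hV ⟨x, hxA, hxU⟩ ⟨y, hyA, hyV⟩
      obtain ⟨U', hU', hxU', hUU⟩ := hB.exists_subset_of_mem_open hxU hU
      obtain ⟨V', hV', hyV', hVV⟩ := hB.exists_subset_of_mem_open hyV hV
      rcases h U' hU' V' hV' with (h | h) | h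
      · exact absurd h (Nonempty.ne_empty ⟨x, hxA, hxU'⟩)
      · exact absurd h (Nonempty.ne_empty ⟨y, hyA, hyV'⟩)
      · exact h.mono (inter_subset_inter_right _ (inter_subset_inter hUU hVV))
  rw [h]
  have hBc := countable_countableBasis X
  exact .biInter hBc fun U hU => .biInter hBc fun V hV =>
    ((isGδ_fellTop_setOf_inter_isOpen_eq_empty (hB.isOpen hU)).union
      (isGδ_fellTop_setOf_inter_isOpen_eq_empty (hB.isOpen hV))).union
      (isOpen_fellTop_setOf_inter_nonempty ((hB.isOpen hU).inter (hB.isOpen hV))).isGδ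

theorem isGδ_fellTop_setOf_closure_isSeparatedPt
    (hBaire : ∀ C : Set X, IsClosed C → BaireSpace C) :
    @IsGδ (Closeds X) (fellTop X)
      {A : Closeds X | ∃ x : X, IsSeparatedPt x ∧ (A : Set X) = closure {x}} := by
  let := fellTop X
  obtain ⟨𝒞, h𝒞, h𝒞c, h𝒞n⟩ := exists_countable_isCompact_nhds (X := X)
  have h : {A : Closeds X | ∃ x : X, IsSeparatedPt x ∧ (A : Set X) = closure {x}} =
      ({A : Closeds X | ((A : Set X) ∩ univ).Nonempty} ∩
        {A : Closeds X | IsPreirreducible (A : Set X)}) ∩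
      ⋂ C ∈ 𝒞, {A : Closeds X | ((A : Set X) ∩ C).Nonempty} ∪
        {A : Closeds X | ((A : Set X) ∩ interior Cᶜ).Nonempty} := by
    ext A
    simp only [mem_ofPred_eq, mem_iInter, mem_union, mem_inter_iff, inter_univ]
    constructor
    · rintro ⟨x, hx, hA⟩
      rw [hA]
      refine ⟨isIrreducible_singleton.closure, fun C hC => or_iff_not_imp_left.2 fun h => ?_⟩
      exact ⟨x, subset_closure rfl, hx.mem_interior_compl (h𝒞c C hC)
        (disjoint_iff_inter_eq_empty.2 (not_nonempty_iff_eq_empty.1 h))⟩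
    · rintro ⟨hA, h⟩
      have := hBaire A A.isClosed
      obtain ⟨x, hx⟩ := IsIrreducible.exists_eq_closure_singleton hA A.isClosed
      refine ⟨x, isSeparatedPt_of_forall_compact h𝒞n fun C hC => ?_, hx⟩
      rw [hx] at h
      refine (h C hC).imp_right fun h => ?_
      simpa using (closure_inter_open_nonempty_iff isOpen_interior).1 h
  rw [h]
  exact ((isOpen_fellTop_setOf_inter_nonempty isOpen_univ).isGδ.inter
    isGδ_fellTop_setOf_isPreirreducible).inter <| .biInter h𝒞 fun C hC =>
      (isGδ_fellTop_setOf_inter_isCompact_nonempty (h𝒞c C hC)).union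
        (isOpen_fellTop_setOf_inter_nonempty isOpen_interior).isGδ

end FellTopology

/-- if `X` is a second countable locally compact space all of whose closed
subsets are Baire spaces, then `{closure {x} : x separated in X}` is a `G_δ` subset of
`(L(X), τ_s)` and a dense subset of `ML(X)`. -/
theorem separated_closures_isGδ_and_dense {X : Type u} [TopologicalSpace X]
    [SecondCountableTopology X] [LocallyCompactSpace X]
    (hBaire : ∀ C : Set X, IsClosed C → BaireSpace C) :
    @IsGδ (LX X) (fellTopL X)
      {A : LX X | ∃ x : X, IsSeparatedPt x ∧ ((A : Closeds X) : Set X) = closure {x}} ∧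
    @Dense (MLX X) (fellTopML X)
      {A : MLX X | ∃ x : X, IsSeparatedPt x ∧ ((A : Closeds X) : Set X) = closure {x}} := by
  constructor
  · exact @IsGδ.preimage (LX X) (Closeds X) (fellTopL X) (fellTop X) Subtype.val _
      continuous_induced_dom (isGδ_fellTop_setOf_closure_isSeparatedPt hBaire)
  · let := fellTop X
    have : BaireSpace X :=
      have := hBaire univ isClosed_univ
      (Homeomorph.Set.univ X).baireSpace
    refine (isTopologicalBasis_fellTop.induced
      (Subtype.val : MLX X → Closeds X)).dense_iff.2 ?_
    rintro _ ⟨_, ⟨C, Φ, hC, hΦ, rfl⟩, rfl⟩ ⟨A, hAC, hAΦ⟩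
    obtain ⟨W, hW, hWne, hWx⟩ :=
      A.2.exists_isOpen_closure hC (disjoint_iff_inter_eq_empty.2 hAC) hΦ hAΦ
    obtain ⟨x, hxW, hx⟩ := dense_setOf_isSeparatedPt.inter_open_nonempty W hW hWne
    obtain ⟨h₁, h₂⟩ := hWx x hxW
    exact ⟨⟨Closeds.closure {x}, hx.isMaxLimitSet⟩,
      ⟨disjoint_iff_inter_eq_empty.1 h₁, h₂⟩, x, hx, rfl⟩
end
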